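/- The number of boolean permutations in S_n equals F_{2n−1}, where F_1 = F_2 = 1 and F_{m+2} = F_{m+1} + F_m are the Fibonacci numbers. -/

import Mathlib

namespace Paper

/-! ### Type A: the symmetric group `S_n` as `Equiv.Perm (Fin n)` -/

/-- The simple transposition `s_i ∈ S_n` (1-indexed letter `i`, meaningful for
`1 ≤ i ≤ n-1`): it interchanges the entries in (1-indexed) positions `i` and `i+1`,
i.e. (0-indexed) positions `i-1` and `i` of `Fin n`. Out-of-range letters give `1`. -/
def sA (n : ℕ) (i : ℕ) : Equiv.Perm (Fin n) :=
  if h : 1 ≤ i ∧ i < n then Equiv.swap ⟨i - 1, by omega⟩ ⟨i, h.2⟩ else 1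

/-- The product `s_{i_1} ⋯ s_{i_ℓ}` of a word `i_1 ⋯ i_ℓ`. -/
def prodA (n : ℕ) (w : List ℕ) : Equiv.Perm (Fin n) := (w.map (sA n)).prod

/-- A word in the letters `{1, …, n-1}`. -/
def IsWordA (n : ℕ) (w : List ℕ) : Prop := ∀ i ∈ w, 1 ≤ i ∧ i ≤ n - 1

/-- `w` is a reduced decomposition of `x ∈ S_n`. -/
def ReducedA (n : ℕ) (w : List ℕ) (x : Equiv.Perm (Fin n)) : Prop :=
  IsWordA n w ∧ prodA n w = x ∧
    ∀ w' : List ℕ, IsWordA n w' → prodA n w' = x → w.length ≤ w'.length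

/-- The Coxeter length `ℓ(x)`: minimal length of a word for `x`. -/
noncomputable def lenA (n : ℕ) (x : Equiv.Perm (Fin n)) : ℕ :=
  sInf {l | ∃ w : List ℕ, IsWordA n w ∧ prodA n w = x ∧ w.length = l}

/-- Bruhat order on `S_n`: `v ≤ w` iff some reduced decomposition of `v` is a
(not necessarily consecutive) subword of some reduced decomposition of `w`. -/
def bruhatA (n : ℕ) (v w : Equiv.Perm (Fin n)) : Prop :=
  ∃ a b : List ℕ, ReducedA n a v ∧ ReducedA n b w ∧ a.Sublist b

/-- `w ∈ S_n` is boolean: the principal order ideal `B(w)`, ordered by the Bruhat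
order, is order-isomorphic to the lattice of all subsets of `{1,…,r}` for some `r`. -/
def BooleanA (n : ℕ) (w : Equiv.Perm (Fin n)) : Prop :=
  ∃ (r : ℕ) (e : {v : Equiv.Perm (Fin n) // bruhatA n v w} ≃ Finset (Fin r)),
    ∀ a b : {v : Equiv.Perm (Fin n) // bruhatA n v w}, bruhatA n a.1 b.1 ↔ e a ⊆ e b

/-- Pattern containment: `w ∈ S_n` contains `p ∈ S_k`. -/
def ContainsA {n k : ℕ} (w : Equiv.Perm (Fin n)) (p : Equiv.Perm (Fin k)) : Prop :=
  ∃ f : Fin k → Fin n, StrictMono f ∧ ∀ a b : Fin k, w (f a) < w (f b) ↔ p a < p b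

/-- Pattern avoidance. -/
def AvoidsA {n k : ℕ} (w : Equiv.Perm (Fin n)) (p : Equiv.Perm (Fin k)) : Prop :=
  ¬ ContainsA w p

/-- The pattern `321` (one-line notation). -/
def p321 : Equiv.Perm (Fin 3) := ⟨![2,1,0], ![2,1,0], by decide, by decide⟩
/-- The pattern `231` (one-line notation). -/
def p231 : Equiv.Perm (Fin 3) := ⟨![1,2,0], ![2,0,1], by decide, by decide⟩
/-- The pattern `312` (one-line notation). -/
def p312 : Equiv.Perm (Fin 3) := ⟨![2,0,1], ![1,2,0], by decide, by decide⟩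
/-- The pattern `3412` (one-line notation). -/
def p3412 : Equiv.Perm (Fin 4) := ⟨![2,3,0,1], ![2,3,0,1], by decide, by decide⟩

/-- The longest (decreasing) permutation `w_0^{(k)} = k (k-1) ⋯ 2 1 ∈ S_k`. -/
def w0 (k : ℕ) : Equiv.Perm (Fin k) := Fin.revPerm

/-- The shift of a word by `M`: each letter `i` becomes `i + M`. -/
def shift (M : ℕ) (w : List ℕ) : List ℕ := w.map (· + M)




/-! ### Types B and D: signed permutations, modelled as permutations `w` of `ℤ`
with `w(-x) = -w(x)` that fix all integers of absolute value `> n`. -/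

/-- The simple generators of `S_n^B`, as permutations of `ℤ`:
`sB 0` negates the value `1`; for `i ≥ 1`, `sB i` interchanges the values
`i` and `i+1` (and `-i` and `-(i+1)`). -/
def sB : ℕ → Equiv.Perm ℤ
  | 0 => Equiv.swap 1 (-1)
  | (i+1) => Equiv.swap ((i : ℤ) + 1) ((i : ℤ) + 2) * Equiv.swap (-((i : ℤ) + 1)) (-((i : ℤ) + 2))

/-- The simple generators of `S_n^D`: letter `0` encodes `s_{1'} = s_0 s_1 s_0`
(mapping `1 ↦ -2` and `2 ↦ -1`), and letters `i ≥ 1` are as in type `B`. -/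
def sD : ℕ → Equiv.Perm ℤ
  | 0 => sB 0 * sB 1 * sB 0
  | (i+1) => sB (i+1)

def prodB (w : List ℕ) : Equiv.Perm ℤ := (w.map sB).prod
def prodD (w : List ℕ) : Equiv.Perm ℤ := (w.map sD).prod

/-- A word in the type `B`/`D` letters `{0, 1, …, n-1}`. -/
def IsWordBD (n : ℕ) (w : List ℕ) : Prop := ∀ i ∈ w, i ≤ n - 1

/-- `w` is a reduced decomposition of `x ∈ S_n^B`. -/
def ReducedB (n : ℕ) (w : List ℕ) (x : Equiv.Perm ℤ) : Prop :=
  IsWordBD n w ∧ prodB w = x ∧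
    ∀ w' : List ℕ, IsWordBD n w' → prodB w' = x → w.length ≤ w'.length

/-- `w` is a reduced decomposition of `x ∈ S_n^D`. -/
def ReducedD (n : ℕ) (w : List ℕ) (x : Equiv.Perm ℤ) : Prop :=
  IsWordBD n w ∧ prodD w = x ∧
    ∀ w' : List ℕ, IsWordBD n w' → prodD w' = x → w.length ≤ w'.length

/-- Length in `S_n^B`. -/
noncomputable def lenB (n : ℕ) (x : Equiv.Perm ℤ) : ℕ :=
  sInf {l | ∃ w : List ℕ, IsWordBD n w ∧ prodB w = x ∧ w.length = l}

/-- Length in `S_n^D`. -/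
noncomputable def lenD (n : ℕ) (x : Equiv.Perm ℤ) : ℕ :=
  sInf {l | ∃ w : List ℕ, IsWordBD n w ∧ prodD w = x ∧ w.length = l}

/-- Bruhat order on `S_n^B`. -/
def bruhatB (n : ℕ) (v w : Equiv.Perm ℤ) : Prop :=
  ∃ a b : List ℕ, ReducedB n a v ∧ ReducedB n b w ∧ a.Sublist b

/-- Bruhat order on `S_n^D`. -/
def bruhatD (n : ℕ) (v w : Equiv.Perm ℤ) : Prop :=
  ∃ a b : List ℕ, ReducedD n a v ∧ ReducedD n b w ∧ a.Sublist b

/-- `w` is an element of `S_n^B`: an "odd" permutation of `{±1, …, ±n}`. -/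
def IsSignedPerm (n : ℕ) (w : Equiv.Perm ℤ) : Prop :=
  (∀ x : ℤ, w (-x) = - w x) ∧ ∀ x : ℤ, (n : ℤ) < |x| → w x = x

/-- `w` is an element of `S_n^D`: a signed permutation with an even number of
negative values in its one-line notation. -/
def IsTypeD (n : ℕ) (w : Equiv.Perm ℤ) : Prop :=
  IsSignedPerm n w ∧ Even (((Finset.Icc (1 : ℤ) n).filter (fun x => w x < 0)).card)

/-- `w ∈ S_n^B` is boolean (for the type `B` Bruhat order). -/
def BooleanB (n : ℕ) (w : Equiv.Perm ℤ) : Prop :=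
  ∃ (r : ℕ) (e : {v : Equiv.Perm ℤ // bruhatB n v w} ≃ Finset (Fin r)),
    ∀ a b : {v : Equiv.Perm ℤ // bruhatB n v w}, bruhatB n a.1 b.1 ↔ e a ⊆ e b

/-- `w ∈ S_n^D` is boolean (for the type `D` Bruhat order). -/
def BooleanD (n : ℕ) (w : Equiv.Perm ℤ) : Prop :=
  ∃ (r : ℕ) (e : {v : Equiv.Perm ℤ // bruhatD n v w} ≃ Finset (Fin r)),
    ∀ a b : {v : Equiv.Perm ℤ // bruhatD n v w}, bruhatD n a.1 b.1 ↔ e a ⊆ e b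

/-- Signed pattern containment, where the pattern is given by its one-line
notation `p` (a list of nonzero integers): there are positions
`1 ≤ f 0 < ⋯ < f (k-1) ≤ n` such that each `w (f j)` has the same sign as the
`j`-th entry of `p`, and the absolute values appear in the same relative order. -/
def containsPat (n : ℕ) (w : Equiv.Perm ℤ) (p : List ℤ) : Prop :=
  ∃ f : Fin p.length → ℤ, StrictMono f ∧ (∀ j, 1 ≤ f j ∧ f j ≤ (n : ℤ)) ∧
    (∀ j, 0 < w (f j) ↔ 0 < p.get j) ∧
    (∀ j j', |w (f j)| < |w (f j')| ↔ |p.get j| < |p.get j'|)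

/-- Signed pattern avoidance. -/
def avoidsPat (n : ℕ) (w : Equiv.Perm ℤ) (p : List ℤ) : Prop := ¬ containsPat n w p


/-! ### Extra definitions used in some statements -/

/-- `w ∈ S_n` is decomposable: `B(w) ≅ B(u) × B(v)` (as posets under Bruhat order)
for some `u ∈ S_m`, `v ∈ S_{m'}` with `m, m' < n`. -/
def Decomposable (n : ℕ) (w : Equiv.Perm (Fin n)) : Prop :=
  ∃ (m m' : ℕ), m < n ∧ m' < n ∧
    ∃ (u : Equiv.Perm (Fin m)) (v : Equiv.Perm (Fin m'))
      (e : {x : Equiv.Perm (Fin n) // bruhatA n x w} ≃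
        {y : Equiv.Perm (Fin m) // bruhatA m y u} × {z : Equiv.Perm (Fin m') // bruhatA m' z v}),
      ∀ a b : {x : Equiv.Perm (Fin n) // bruhatA n x w},
        bruhatA n a.1 b.1 ↔
          (bruhatA m ((e a).1).1 ((e b).1).1 ∧ bruhatA m' ((e a).2).1 ((e b).2).1)

/-- `w` is decreasing on the set of positions `T`. -/
def DecrOn (n : ℕ) (w : Equiv.Perm (Fin n)) (T : Finset (Fin n)) : Prop :=
  ∀ a ∈ T, ∀ b ∈ T, a < b → w b < w a

/-- Every inversion of `w` lies in exactly one occurrence of the decreasing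
pattern `w_0^{(k)}`: for every `i < j` with `w i > w j` there is exactly one
`k`-element set of positions containing `i` and `j` on which `w` is decreasing. -/
def EveryInvOnce (n k : ℕ) (w : Equiv.Perm (Fin n)) : Prop :=
  ∀ i j : Fin n, i < j → w j < w i →
    ∃! T : Finset (Fin n), T.card = k ∧ DecrOn n w T ∧ i ∈ T ∧ j ∈ T

/-- Equality of two patterns of (possibly a priori different) sizes. -/
def EqPat {k m : ℕ} (p : Equiv.Perm (Fin k)) (q : Equiv.Perm (Fin m)) : Prop :=
  ∃ h : k = m, ∀ i : Fin k, ((p i : ℕ) = (q (Fin.cast h i) : ℕ))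

/-- `L(n,k)`: the number of boolean permutations in `S_n` of length `k`. -/
noncomputable def LA (n k : ℕ) : ℕ :=
  Nat.card {w : Equiv.Perm (Fin n) // BooleanA n w ∧ lenA n w = k}

/-- `L` extended to integer arguments, with the convention that it vanishes
when `m < 1` or `j < 0`. -/
noncomputable def Lz (m j : ℤ) : ℤ :=
  if 1 ≤ m ∧ 0 ≤ j then (LA m.toNat j.toNat : ℤ) else 0

/-- `L^D(n,k)`: the number of boolean elements of `S_n^D` of length `k`. -/
noncomputable def LD (n k : ℕ) : ℕ :=
  Nat.card {w : Equiv.Perm ℤ // IsTypeD n w ∧ BooleanD n w ∧ lenD n w = k}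


/-- `x` preserves the set of the first `i` positions. -/
def Pres {n : ℕ} (i : ℕ) (x : Equiv.Perm (Fin n)) : Prop :=
  ∀ p : Fin n, (x p : ℕ) < i ↔ (p : ℕ) < i

theorem Pres.mul {n i : ℕ} {x y : Equiv.Perm (Fin n)} (hx : Pres i x) (hy : Pres i y) :
    Pres i (x * y) := fun p => by
  rw [Equiv.Perm.mul_apply, hx, hy]

theorem Pres.one {n i : ℕ} : Pres i (1 : Equiv.Perm (Fin n)) := fun p => by simp

theorem Pres.inv {n i : ℕ} {x : Equiv.Perm (Fin n)} (hx : Pres i x) : Pres i x⁻¹ := fun p => by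
  have := hx (x⁻¹ p)
  simp at this
  exact this.symm

theorem sA_val {n j : ℕ} (h1 : 1 ≤ j) (h2 : j < n) (p : Fin n) :
    (sA n j p : ℕ) = if (p : ℕ) = j - 1 then j else if (p : ℕ) = j then j - 1 else p := by
  have h : 1 ≤ j ∧ j < n := ⟨h1, h2⟩
  simp only [sA, dif_pos h, Equiv.swap_apply_def, Fin.ext_iff]
  split_ifs <;> rfl

theorem sA_sq (n j : ℕ) : sA n j * sA n j = 1 := by
  unfold sA; split_ifs <;> simp

theorem sA_pres {n i j : ℕ} (hij : j ≠ i) : Pres i (sA n j) := fun p => by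
  by_cases h : 1 ≤ j ∧ j < n
  · rw [sA_val h.1 h.2]; split_ifs <;> omega
  · simp [sA, dif_neg h]

theorem sA_not_pres {n i : ℕ} (h1 : 1 ≤ i) (h2 : i < n) : ¬ Pres i (sA n i) := fun h => by
  have := h ⟨i, h2⟩
  rw [sA_val h1 h2] at this
  simp at this; split_ifs at this <;> omega

theorem prodA_append (n : ℕ) (u v : List ℕ) : prodA n (u ++ v) = prodA n u * prodA n v := by
  simp [prodA]

theorem prodA_cons (n i : ℕ) (v : List ℕ) : prodA n (i :: v) = sA n i * prodA n v := by
  simp [prodA]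

theorem prodA_nil (n : ℕ) : prodA n [] = 1 := by simp [prodA]

theorem prodA_pres {n i : ℕ} {u : List ℕ} (h : i ∉ u) : Pres i (prodA n u) := by
  induction u with
  | nil => exact Pres.one
  | cons j u ih =>
    simp only [List.mem_cons, not_or] at h
    rw [prodA_cons]
    exact (sA_pres (Ne.symm h.1)).mul (ih h.2)

theorem nodup_split {i : ℕ} {c : List ℕ} (hc : c.Nodup) (hi : i ∈ c) :
    ∃ u v, c = u ++ i :: v ∧ i ∉ u ∧ i ∉ v := by
  obtain ⟨u, v, rfl⟩ := List.append_of_mem hi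
  refine ⟨u, v, rfl, ?_, ?_⟩
  · intro h; exact (List.nodup_append.1 hc).2.2 i h i (by simp) rfl
  · have := (List.nodup_append.1 hc).2.1
    exact (List.nodup_cons.1 this).1

theorem not_pres_of_nodup {n i : ℕ} {c : List ℕ} (hc : c.Nodup) (hi : i ∈ c)
    (h1 : 1 ≤ i) (h2 : i < n) : ¬ Pres i (prodA n c) := by
  obtain ⟨u, v, rfl, hu, hv⟩ := nodup_split hc hi
  intro h
  apply sA_not_pres h1 h2
  have : sA n i = (prodA n u)⁻¹ * prodA n (u ++ i :: v) * (prodA n v)⁻¹ := by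
    rw [prodA_append, prodA_cons]; group
  rw [this]
  exact ((prodA_pres hu).inv.mul h).mul (prodA_pres hv).inv

theorem word_bd {n i : ℕ} {c : List ℕ} (hn : 1 ≤ n) (hc : IsWordA n c) (hi : i ∈ c) :
    1 ≤ i ∧ i < n := by
  have := hc i hi; omega

theorem nodup_subset {n : ℕ} (hn : 1 ≤ n) {c d : List ℕ} (hc : c.Nodup) (wc : IsWordA n c)
    (h : prodA n c = prodA n d) : c ⊆ d := by
  intro i hi
  by_contra hd
  have b := word_bd hn wc hi
  exact not_pres_of_nodup hc hi b.1 b.2 (h ▸ prodA_pres hd)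

theorem nodup_reduced {n : ℕ} (hn : 1 ≤ n) {c : List ℕ} (hc : c.Nodup) (wc : IsWordA n c) :
    ReducedA n c (prodA n c) :=
  ⟨wc, rfl, fun d _ h => (hc.subperm (nodup_subset hn hc wc h.symm)).length_le⟩

theorem reduced_perm {n : ℕ} (hn : 1 ≤ n) {c d : List ℕ} (hc : c.Nodup) (wc : IsWordA n c)
    (hd : ReducedA n d (prodA n c)) : c.Perm d :=
  (hc.subperm (nodup_subset hn hc wc hd.2.1.symm)).perm_of_length_le (hd.2.2 c wc rfl)

/-- cancelling a letter -/
theorem cancel_letter {n i : ℕ} (h1 : 1 ≤ i) (h2 : i < n) {u v u' v' : Equiv.Perm (Fin n)}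
    (hu : Pres i u) (hv : Pres i v) (hu' : Pres i u') (hv' : Pres i v')
    (h : u * (sA n i * v) = u' * (sA n i * v')) : u * v = u' * v' := by
  have hg : Pres i (u'⁻¹ * u) := hu'.inv.mul hu
  have hh : Pres i (v' * v⁻¹) := hv'.mul hv.inv
  generalize hG : u'⁻¹ * u = g at hg
  generalize hH : v' * v⁻¹ = k at hh
  have e : g * sA n i = sA n i * k := by
    rw [← hG, ← hH]
    calc u'⁻¹ * u * sA n i = u'⁻¹ * (u * (sA n i * v)) * v⁻¹ := by group
      _ = _ := by rw [h]; group
  have ea : ∀ p, g (sA n i p) = sA n i (k p) := fun p => by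
    have := congrArg (fun f => f p) e
    simpa using this
  have ka : k ⟨i - 1, by omega⟩ = ⟨i - 1, by omega⟩ := by
    have a1 := congrArg Fin.val (ea ⟨i - 1, by omega⟩)
    have a2 := hg (sA n i ⟨i - 1, by omega⟩)
    have a3 := hh ⟨i - 1, by omega⟩
    rw [a1, sA_val h1 h2, sA_val h1 h2] at a2
    ext
    simp at a2 a3 ⊢
    split_ifs at a2 <;> omega
  have kb : k ⟨i, h2⟩ = ⟨i, h2⟩ := by
    have a1 := congrArg Fin.val (ea ⟨i, h2⟩)
    have a2 := hg (sA n i ⟨i, h2⟩)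
    have a3 := hh ⟨i, h2⟩
    rw [a1, sA_val h1 h2, sA_val h1 h2] at a2
    ext
    simp at a2 a3 ⊢
    split_ifs at a2 <;> omega
  have comm : k * sA n i = sA n i * k := by
    have h : 1 ≤ i ∧ i < n := ⟨h1, h2⟩
    simp only [sA, dif_pos h]
    rw [Equiv.mul_swap_eq_swap_mul, ka, kb]
  have gk : g = k := by
    rw [← comm] at e
    exact mul_right_cancel e
  have : u'⁻¹ * u = v' * v⁻¹ := by rw [hG, hH, gk]
  calc u * v = u' * (u'⁻¹ * u) * v := by group
    _ = _ := by rw [this]; group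

theorem delete_one {n : ℕ} (hn : 1 ≤ n) (i : ℕ) {c d : List ℕ} (hc : c.Nodup) (hd : d.Nodup)
    (wc : IsWordA n c) (wd : IsWordA n d) (h : prodA n c = prodA n d) :
    prodA n (c.filter (fun x => decide (x ≠ i))) = prodA n (d.filter (fun x => decide (x ≠ i))) := by
  have key : ∀ {c : List ℕ}, i ∉ c → c.filter (fun x => decide (x ≠ i)) = c := by
    intro c hc
    rw [List.filter_eq_self]
    intro a ha
    simp
    rintro rfl
    exact hc ha
  by_cases hi : i ∈ c
  · have hi' := nodup_subset hn hc wc h hi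
    have bd := word_bd hn wc hi
    obtain ⟨u, v, rfl, hu, hv⟩ := nodup_split hc hi
    obtain ⟨u', v', rfl, hu', hv'⟩ := nodup_split hd hi'
    simp only [List.filter_append]
    rw [List.filter_cons_of_neg (by simp), List.filter_cons_of_neg (by simp),
      key hu, key hu', key hv, key hv', prodA_append, prodA_append]
    rw [prodA_append, prodA_append, prodA_cons, prodA_cons] at h
    exact cancel_letter bd.1 bd.2 (prodA_pres hu) (prodA_pres hv) (prodA_pres hu')
      (prodA_pres hv') h
  · have hi' : i ∉ d := fun h' => hi (nodup_subset hn hd wd h.symm h')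
    rw [key hi, key hi', h]

theorem delete_many {n : ℕ} (hn : 1 ≤ n) (l : List ℕ) : ∀ {c d : List ℕ}, c.Nodup → d.Nodup →
    IsWordA n c → IsWordA n d → prodA n c = prodA n d →
    prodA n (c.filter (fun x => decide (x ∉ l))) = prodA n (d.filter (fun x => decide (x ∉ l))) := by
  induction l with
  | nil => intro c d _ _ _ _ h; simpa using h
  | cons i l ih =>
    intro c d hc hd wc wd h
    have := ih (hc.filter (fun x => decide (x ≠ i))) (hd.filter (fun x => decide (x ≠ i)))
      (fun j hj => wc j (List.mem_filter.1 hj).1) (fun j hj => wd j (List.mem_filter.1 hj).1)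
      (delete_one hn i hc hd wc wd h)
    rw [List.filter_filter, List.filter_filter] at this
    convert this using 3 <;> (ext x; simp [Bool.and_comm])

theorem sublist_filter {a c : List ℕ} (h : a.Sublist c) (hc : c.Nodup) :
    c.filter (fun x => decide (x ∈ a)) = a := by
  induction h with
  | slnil => rfl
  | @cons l₁ l₂ x h ih =>
    rw [List.nodup_cons] at hc
    rw [List.filter_cons_of_neg (by simpa using fun h' => hc.1 (h.subset h')), ih hc.2]
  | @cons_cons l₁ l₂ x h ih =>
    rw [List.nodup_cons] at hc
    rw [List.filter_cons_of_pos (by simp)]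
    congr 1
    rw [← ih hc.2]
    apply List.filter_congr
    intro y hy
    have : y ≠ x := by rintro rfl; exact hc.1 hy
    rw [ih hc.2]
    simp [this]

theorem boolean_of_nodup {n : ℕ} (hn : 1 ≤ n) {b : List ℕ} (hb : b.Nodup) (wb : IsWordA n b) :
    BooleanA n (prodA n b) := by
  classical
  let g : Finset (Fin b.length) → List ℕ := fun S =>
    b.filter (fun x => decide (x ∈ S.image b.get))
  have gn : ∀ S, (g S).Nodup := fun S => hb.filter _
  have gw : ∀ S, IsWordA n (g S) := fun S j hj => wb j (List.mem_filter.1 hj).1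
  have gi : Function.Injective b.get := List.nodup_iff_injective_get.1 hb
  have gm : ∀ S i, b.get i ∈ g S ↔ i ∈ S := by
    intro S i
    simp only [g, List.mem_filter, decide_eq_true_eq, Finset.mem_image]
    constructor
    · rintro ⟨_, j, hj, e⟩
      rwa [← gi e]
    · intro h
      exact ⟨List.get_mem _ _, i, h, rfl⟩
  have gred : ∀ S, ReducedA n (g S) (prodA n (g S)) := fun S => nodup_reduced hn (gn S) (gw S)
  have bred := nodup_reduced hn hb wb
  let f : Finset (Fin b.length) → {v : Equiv.Perm (Fin n) // bruhatA n v (prodA n b)} := fun S =>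
    ⟨prodA n (g S), g S, b, gred S, bred, List.filter_sublist⟩
  have ford : ∀ S T, bruhatA n (f S).1 (f T).1 ↔ S ⊆ T := by
    intro S T
    constructor
    · rintro ⟨a, c, ha, hc, hac⟩ i hi
      have p1 := reduced_perm hn (gn S) (gw S) ha
      have p2 := reduced_perm hn (gn T) (gw T) hc
      exact (gm T i).1 (p2.symm.subset (hac.subset (p1.subset ((gm S i).2 hi))))
    · intro h
      refine ⟨g S, g T, gred S, gred T, ?_⟩
      apply List.monotone_filter_right
      intro x hx
      simp only [decide_eq_true_eq] at hx ⊢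
      exact Finset.image_subset_image h hx
  have finj : Function.Injective f := by
    intro S T h
    apply Finset.Subset.antisymm
    · rw [← ford, h]; exact (ford T T).2 subset_rfl
    · rw [← ford, h]; exact (ford T T).2 subset_rfl
  have fsurj : Function.Surjective f := by
    rintro ⟨v, a, c, ha, hc, hac⟩
    have p := reduced_perm hn hb wb hc
    have cn : c.Nodup := p.nodup_iff.1 hb
    refine ⟨Finset.univ.filter (fun i => b.get i ∈ a), Subtype.ext ?_⟩
    change prodA n (b.filter _) = v
    rw [← ha.2.1]
    have D := delete_many hn (c.filter (fun x => decide (x ∉ a))) hb cn wb hc.1 hc.2.1.symm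
    have e1 : c.filter (fun x => decide (x ∉ c.filter (fun x => decide (x ∉ a)))) = a := by
      rw [← sublist_filter hac cn]
      conv_rhs => rw [← sublist_filter hac cn]
      apply List.filter_congr
      intro x hx
      rw [sublist_filter hac cn]
      simp [hx]
    rw [e1] at D
    rw [← D]
    congr 1
    apply List.filter_congr
    intro x hx
    have hx' : x ∈ c := p.subset hx
    obtain ⟨i, rfl⟩ := List.get_of_mem hx
    have : b.get i ∈ (Finset.univ.filter (fun i => b.get i ∈ a)).image b.get ↔ b.get i ∈ a := by
      simp only [Finset.mem_image, Finset.mem_filter, Finset.mem_univ, true_and]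
      constructor
      · rintro ⟨j, hj, e⟩; rwa [← e]
      · intro h; exact ⟨i, h, rfl⟩
    rw [decide_eq_decide, this]
    simp only [List.mem_filter, decide_eq_true_eq]
    tauto
  let E := Equiv.ofBijective f ⟨finj, fsurj⟩
  refine ⟨b.length, E.symm, ?_⟩
  intro x y
  obtain ⟨S, rfl⟩ := E.surjective x
  obtain ⟨T, rfl⟩ := E.surjective y
  rw [Equiv.symm_apply_apply, Equiv.symm_apply_apply]
  exact ford S T

theorem exchange {n : ℕ} (a b : Fin n) (v : List ℕ) :
    ∀ y : Equiv.Perm (Fin n), IsWordA n v → y⁻¹ b < y⁻¹ a →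
      (y * prodA n v)⁻¹ a < (y * prodA n v)⁻¹ b →
      ∃ v', IsWordA n v' ∧ v'.length < v.length ∧
        y * prodA n v = Equiv.swap a b * y * prodA n v' := by
  induction v with
  | nil =>
    intro y _ h1 h2
    rw [prodA_nil, mul_one] at h2
    exact absurd h1 (not_lt.2 h2.le)
  | cons j v ih =>
    intro y wv h1 h2
    have wv' : IsWordA n v := fun i hi => wv i (List.mem_cons_of_mem _ hi)
    have wj : 1 ≤ j ∧ j < n := by
      have := wv j (by simp)
      have := (y⁻¹ b).2
      omega
    rw [prodA_cons, ← mul_assoc] at h2 ⊢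
    by_cases h3 : (y * sA n j)⁻¹ b < (y * sA n j)⁻¹ a
    · obtain ⟨v', wv'', hl, e⟩ := ih _ wv' h3 h2
      refine ⟨j :: v', ?_, by simpa using hl, ?_⟩
      · intro i hi
        rcases List.mem_cons.1 hi with rfl | hi
        · exact wv i (by simp)
        · exact wv'' i hi
      · rw [e, prodA_cons]; group
    · refine ⟨v, wv', by simp, ?_⟩
      congr 1
      have sinv : (sA n j)⁻¹ = sA n j := inv_eq_of_mul_eq_one_left (sA_sq n j)
      rw [mul_inv_rev, sinv, Equiv.Perm.mul_apply, Equiv.Perm.mul_apply, Fin.lt_def,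
        sA_val wj.1 wj.2, sA_val wj.1 wj.2] at h3
      rw [Fin.lt_def] at h1
      have hh : ((y⁻¹ b : Fin n) : ℕ) = j - 1 ∧ ((y⁻¹ a : Fin n) : ℕ) = j := by
        split_ifs at h3 <;> omega
      have hb : y⁻¹ b = ⟨j - 1, by omega⟩ := Fin.ext hh.1
      have ha : y⁻¹ a = ⟨j, by omega⟩ := Fin.ext hh.2
      simp only [sA, dif_pos wj]
      rw [Equiv.mul_swap_eq_swap_mul, ← hb, ← ha]
      simp [Equiv.swap_comm]

theorem not_pres_of_reduced {n : ℕ} (hn : 1 ≤ n) {c : List ℕ} {x : Equiv.Perm (Fin n)}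
    (hc : ReducedA n c x) {i : ℕ} (hi : i ∈ c) : ¬ Pres i x := by
  intro hp
  have bd := word_bd hn hc.1 hi
  obtain ⟨u, v, rfl, hu⟩ : ∃ u v, c = u ++ i :: v ∧ i ∉ u := by
    obtain ⟨u, v, h1, h2⟩ := List.eq_append_cons_of_mem hi
    exact ⟨u, v, h1, h2⟩
  have e := hc.2.1
  rw [prodA_append, prodA_cons, ← mul_assoc] at e
  set U := prodA n u with hU
  have pu : Pres i U := prodA_pres hu
  set a := U ⟨i - 1, by omega⟩ with ha
  set b := U ⟨i, bd.2⟩ with hb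
  have sinv : (sA n i)⁻¹ = sA n i := inv_eq_of_mul_eq_one_left (sA_sq n i)
  have ssw : sA n i = Equiv.swap ⟨i - 1, by omega⟩ ⟨i, bd.2⟩ := by
    simp only [sA, dif_pos bd]
  have wc := hc.1
  have wv : IsWordA n v := fun j hj => wc j (by simp [hj])
  have wu : IsWordA n u := fun j hj => wc j (by simp [hj])
  have h1 : (U * sA n i)⁻¹ b < (U * sA n i)⁻¹ a := by
    have ia : U⁻¹ a = ⟨i - 1, by omega⟩ := by rw [ha]; simp
    have ib : U⁻¹ b = ⟨i, bd.2⟩ := by rw [hb]; simp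
    rw [mul_inv_rev, sinv, Equiv.Perm.mul_apply, Equiv.Perm.mul_apply, ia, ib, ssw, Equiv.swap_apply_left,
      Equiv.swap_apply_right, Fin.lt_def]
    simp; omega
  have h2 : (U * sA n i * prodA n v)⁻¹ a < (U * sA n i * prodA n v)⁻¹ b := by
    rw [e, Fin.lt_def]
    have q1 := hp.inv a
    have q2 := hp.inv b
    have q3 := pu ⟨i - 1, by omega⟩
    have q4 := pu ⟨i, bd.2⟩
    rw [← ha] at q3
    rw [← hb] at q4
    simp only [] at q3 q4
    omega
  obtain ⟨v', wv', hl, e'⟩ := exchange a b v _ wv h1 h2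
  have e2 : Equiv.swap a b * (U * sA n i) = U := by
    have : U * sA n i = Equiv.swap a b * U := by
      rw [ssw, Equiv.mul_swap_eq_swap_mul]
    rw [this, ← mul_assoc, Equiv.swap_mul_self, one_mul]
  rw [e2, e] at e'
  have := hc.2.2 (u ++ v') (by
    intro j hj
    rcases List.mem_append.1 hj with h | h
    · exact wu j h
    · exact wv' j h) (by rw [prodA_append, e'])
  simp at this
  omega

theorem reduced_left {n : ℕ} {u v : List ℕ} {x : Equiv.Perm (Fin n)}
    (h : ReducedA n (u ++ v) x) : ReducedA n u (prodA n u) := by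
  refine ⟨fun j hj => h.1 j (by simp [hj]), rfl, ?_⟩
  intro d wd hd
  have := h.2.2 (d ++ v) (by
    intro j hj
    rcases List.mem_append.1 hj with h' | h'
    · exact wd j h'
    · exact h.1 j (by simp [h'])) (by rw [← h.2.1, prodA_append, prodA_append, hd])
  simpa using this

theorem reduced_single {n : ℕ} {i : ℕ} (h1 : 1 ≤ i) (h2 : i < n) : ReducedA n [i] (sA n i) := by
  have := nodup_reduced (n := n) (c := [i]) (by omega) (by simp) (by
    intro j hj
    simp at hj
    omega)
  rwa [prodA_cons, prodA_nil, mul_one] at this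

theorem nil_reduced {n : ℕ} : ReducedA n [] 1 := ⟨by intro i hi; simp at hi, prodA_nil n, by simp⟩

theorem nodup_of_boolean {n : ℕ} (hn : 1 ≤ n) {w : Equiv.Perm (Fin n)} (h : BooleanA n w) :
    ∃ b : List ℕ, b.Nodup ∧ IsWordA n b ∧ prodA n b = w := by
  classical
  obtain ⟨r, e, he⟩ := h
  obtain ⟨b, hb⟩ : ∃ b, ReducedA n b w := by
    obtain ⟨_, _, b, _, hb, _⟩ := e.symm ∅
    exact ⟨b, hb⟩
  refine ⟨b, ?_, hb.1, hb.2.1⟩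
  -- prefixes
  have tred : ∀ j, ReducedA n (b.take j) (prodA n (b.take j)) := fun j =>
    reduced_left (v := b.drop j) (x := w) (by rwa [List.take_append_drop])
  let P : ℕ → {v : Equiv.Perm (Fin n) // bruhatA n v w} := fun j =>
    ⟨prodA n (b.take j), b.take j, b, tred j, hb, List.take_sublist _ _⟩
  have hP : ∀ j, j ≤ b.length → j ≤ (e (P j)).card := by
    intro j
    induction j with
    | zero => intro; omega
    | succ j ih =>
      intro hj
      have := ih (by omega)
      have hs : e (P j) ⊆ e (P (j + 1)) := by
        rw [← he]
        exact ⟨_, _, tred j, tred (j + 1), List.take_sublist_take_left (by omega)⟩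
      have hne : e (P j) ≠ e (P (j + 1)) := by
        intro h
        have h' : prodA n (b.take j) = prodA n (b.take (j + 1)) :=
          congrArg Subtype.val (e.injective h)
        have := (tred (j + 1)).2.2 _ (tred j).1 h'
        simp at this
        omega
      have := Finset.card_lt_card (Finset.ssubset_iff_subset_ne.2 ⟨hs, hne⟩)
      omega
  have hlr : b.length ≤ r := by
    have h1 := hP b.length le_rfl
    have h2 := Finset.card_le_univ (e (P b.length))
    simp at h2
    omega
  -- atoms
  let o : {v : Equiv.Perm (Fin n) // bruhatA n v w} := ⟨1, [], b, nil_reduced, hb, by simp⟩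
  have ho : e o = ∅ := by
    obtain ⟨z, hz⟩ := e.surjective ∅
    have : e o ⊆ e z := by
      rw [← he]
      obtain ⟨a, c, ha, hc, hac⟩ := z.2
      exact ⟨[], a, nil_reduced, ha, by simp⟩
    rw [hz] at this
    exact Finset.subset_empty.1 this
  have atom : ∀ i : Fin r, ∃ s ∈ b.toFinset,
      ∃ z : {v : Equiv.Perm (Fin n) // bruhatA n v w}, z.1 = sA n s ∧ e z = {i} := by
    intro i
    obtain ⟨z, hz⟩ := e.surjective {i}
    obtain ⟨a, c, ha, hc, hac⟩ := z.2
    cases a with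
    | nil =>
      exfalso
      have : z = o := Subtype.ext (by rw [← ha.2.1, prodA_nil])
      rw [this, ho] at hz
      exact (Finset.singleton_ne_empty i) hz.symm
    | cons s a =>
      have bd := word_bd hn ha.1 (i := s) (by simp)
      have sc : s ∈ c := hac.subset (by simp)
      have rs := reduced_single bd.1 bd.2
      refine ⟨s, ?_, ⟨sA n s, [s], c, rs, hc, List.singleton_sublist.2 sc⟩, rfl, ?_⟩
      · rw [List.mem_toFinset]
        by_contra hs
        apply not_pres_of_reduced hn hc sc
        rw [← hb.2.1]
        exact prodA_pres hs
      · generalize hy : (⟨sA n s, [s], c, rs, hc, List.singleton_sublist.2 sc⟩ :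
          {v : Equiv.Perm (Fin n) // bruhatA n v w}) = y
        have hy1 : y.1 = sA n s := by rw [← hy]
        have hsub : e y ⊆ e z := by
          rw [← he, hy1]
          exact ⟨[s], s :: a, rs, ha, by simp⟩
        rw [hz, Finset.subset_singleton_iff] at hsub
        rcases hsub with h | h
        · exfalso
          rw [← ho] at h
          have h' := congrArg Subtype.val (e.injective h)
          rw [hy1] at h'
          apply sA_not_pres bd.1 bd.2
          rw [h']
          exact Pres.one
        · exact h
  choose s hs z hz1 hz2 using atom
  have sinj : Function.Injective s := by
    intro i j hij
    have : z i = z j := Subtype.ext (by rw [hz1, hz1, hij])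
    have h2 := hz2 i
    rw [this, hz2 j] at h2
    exact (Finset.singleton_injective h2).symm
  have hcard : r ≤ b.toFinset.card := by
    have := Finset.card_le_card_of_injOn (s := Finset.univ) (t := b.toFinset) s
      (fun i _ => hs i) (sinj.injOn)
    simpa using this
  have h3 := List.toFinset_card_le b
  rw [← Multiset.coe_nodup, ← Multiset.toFinset_card_eq_card_iff_nodup]
  simp only [Multiset.coe_card]
  change b.toFinset.card = b.length
  omega

/-- products of repetition-free words in the letters `1, …, k` -/
def DD (n k : ℕ) : Set (Equiv.Perm (Fin n)) :=
  {x | ∃ b : List ℕ, b.Nodup ∧ (∀ i ∈ b, 1 ≤ i ∧ i ≤ k) ∧ prodA n b = x}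

theorem DD_pres {n k m : ℕ} (hm : k < m) {x : Equiv.Perm (Fin n)} (hx : x ∈ DD n k) :
    Pres m x := by
  obtain ⟨b, _, hb, rfl⟩ := hx
  exact prodA_pres (fun h => by have := hb m h; omega)

theorem DD_mono {n k m : ℕ} (hm : k ≤ m) : DD n k ⊆ DD n m := by
  rintro x ⟨b, h1, h2, h3⟩
  exact ⟨b, h1, fun i hi => by have := h2 i hi; omega, h3⟩

theorem sA_comm {n i j : ℕ} (h : i + 1 < j) : sA n i * sA n j = sA n j * sA n i := by
  by_cases hi : 1 ≤ i ∧ i < n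
  · by_cases hj : 1 ≤ j ∧ j < n
    · ext p
      simp only [Equiv.Perm.mul_apply, sA_val hi.1 hi.2, sA_val hj.1 hj.2]
      split_ifs <;> omega
    · simp [sA, dif_neg hj]
  · simp [sA, dif_neg hi]

theorem prod_comm {n j : ℕ} {u : List ℕ} (h : ∀ i ∈ u, i + 1 < j) :
    prodA n u * sA n j = sA n j * prodA n u := by
  induction u with
  | nil => simp [prodA_nil]
  | cons i u ih =>
    rw [prodA_cons, mul_assoc, ih (fun i hi => h i (by simp [hi])), ← mul_assoc,
      sA_comm (h i (by simp)), mul_assoc]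

theorem DD_succ {n k : ℕ} :
    DD n (k + 1) = DD n k ∪ ((fun y => y * sA n (k + 1)) '' DD n k ∪
      (fun y => sA n (k + 1) * y) '' DD n k) := by
  ext x
  constructor
  · rintro ⟨b, hb, hl, rfl⟩
    by_cases hk : k + 1 ∈ b
    · right
      obtain ⟨u, v, rfl, hu, hv⟩ := nodup_split hb hk
      have lu : ∀ i ∈ u, 1 ≤ i ∧ i ≤ k := fun i hi => by
        have := hl i (by simp [hi])
        have : i ≠ k + 1 := by rintro rfl; exact hu hi
        omega
      have lv : ∀ i ∈ v, 1 ≤ i ∧ i ≤ k := fun i hi => by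
        have := hl i (by simp [hi])
        have : i ≠ k + 1 := by rintro rfl; exact hv hi
        omega
      have huv : prodA n u * prodA n v ∈ DD n k := by
        refine ⟨u ++ v, ?_, ?_, prodA_append _ _ _⟩
        · exact hb.sublist (by simp)
        · intro i hi
          rcases List.mem_append.1 hi with h | h
          · exact lu i h
          · exact lv i h
      by_cases hkv : k ∈ v
      · right
        refine ⟨_, huv, ?_⟩
        have hku : k ∉ u := fun h => (List.nodup_append.1 hb).2.2 k h k (by simp [hkv]) rfl
        have := prod_comm (n := n) (j := k + 1) (u := u) (fun i hi => by
          have := lu i hi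
          have : i ≠ k := by rintro rfl; exact hku hi
          omega)
        simp only []
        rw [prodA_append, prodA_cons, ← mul_assoc, ← mul_assoc, this]
      · left
        refine ⟨_, huv, ?_⟩
        have := prod_comm (n := n) (j := k + 1) (u := v) (fun i hi => by
          have := lv i hi
          have : i ≠ k := by rintro rfl; exact hkv hi
          omega)
        simp only []
        rw [prodA_append, prodA_cons, mul_assoc, this]
    · left
      refine ⟨b, hb, fun i hi => ?_, rfl⟩
      have := hl i hi
      have : i ≠ k + 1 := by rintro rfl; exact hk hi
      omega
  · rintro (h | ⟨_, ⟨b, hb, hl, rfl⟩, rfl⟩ | ⟨_, ⟨b, hb, hl, rfl⟩, rfl⟩)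
    · exact DD_mono (by omega) h
    · have hk : k + 1 ∉ b := fun h => by have := hl _ h; omega
      refine ⟨b ++ [k + 1], ?_, ?_, by simp [prodA]⟩
      · rw [List.nodup_append]
        refine ⟨hb, by simp, ?_⟩
        intro a ha c hc h
        simp at hc
        subst hc
        exact hk (h ▸ ha)
      · intro i hi
        rcases List.mem_append.1 hi with h | h
        · have := hl i h; omega
        · simp at h; omega
    · have hk : k + 1 ∉ b := fun h => by have := hl _ h; omega
      refine ⟨(k + 1) :: b, List.nodup_cons.2 ⟨hk, hb⟩, ?_, by simp [prodA]⟩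
      intro i hi
      rcases List.mem_cons.1 hi with h | h
      · omega
      · have := hl i h; omega

theorem DD_disj {n k : ℕ} (hk : k + 1 < n) :
    Disjoint (DD n k) ((fun y => y * sA n (k + 1)) '' DD n k ∪
      (fun y => sA n (k + 1) * y) '' DD n k) := by
  rw [Set.disjoint_left]
  rintro x hx (⟨y, hy, rfl⟩ | ⟨y, hy, rfl⟩)
  · apply sA_not_pres (n := n) (i := k + 1) (by omega) hk
    have := (DD_pres (Nat.lt_succ_self k) hy).inv.mul (DD_pres (Nat.lt_succ_self k) hx)
    simpa using this
  · apply sA_not_pres (n := n) (i := k + 1) (by omega) hk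
    have := (DD_pres (Nat.lt_succ_self k) hx).mul (DD_pres (Nat.lt_succ_self k) hy).inv
    simpa using this

theorem fix_of_pres {n m : ℕ} (hm : m < n) {x : Equiv.Perm (Fin n)} (h1 : Pres m x)
    (h2 : Pres (m + 1) x) : x ⟨m, hm⟩ = ⟨m, hm⟩ := by
  have a1 := h1 ⟨m, hm⟩
  have a2 := h2 ⟨m, hm⟩
  ext
  simp at a1 a2 ⊢
  omega

theorem DD_inter {n k : ℕ} (hk : k + 2 < n) :
    ((fun y => y * sA n (k + 2)) '' DD n (k + 1)) ∩ ((fun y => sA n (k + 2) * y) '' DD n (k + 1))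
      = (fun y => y * sA n (k + 2)) '' DD n k := by
  ext x
  constructor
  · rintro ⟨⟨y, hy, rfl⟩, ⟨z, hz, h⟩⟩
    refine ⟨y, ?_, rfl⟩
    simp only [] at h
    have fz := fix_of_pres hk (DD_pres (m := k + 2) (by omega) hz) (DD_pres (by omega) hz)
    have bd : 1 ≤ k + 2 ∧ k + 2 < n := ⟨by omega, hk⟩
    have s1 : sA n (k + 2) ⟨k + 2, hk⟩ = ⟨k + 1, by omega⟩ := by
      simp [sA, hk]
    have fy : y ⟨k + 1, by omega⟩ = ⟨k + 1, by omega⟩ := by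
      have := congrArg (fun f => f ⟨k + 2, hk⟩) h
      simp only [Equiv.Perm.mul_apply, fz, s1] at this
      exact this.symm
    have py := DD_pres (m := k + 2) (by omega) hy
    have py' : Pres (k + 1) y := by
      intro p
      by_cases hp : p = ⟨k + 1, by omega⟩
      · rw [hp, fy]
      · have := py p
        have h1 : (p : ℕ) ≠ k + 1 := fun h => hp (Fin.ext h)
        have h2 : (y p : ℕ) ≠ k + 1 := fun h => hp (y.injective (by rw [fy]; exact Fin.ext h))
        omega
    obtain ⟨b, hb, hl, rfl⟩ := hy
    refine ⟨b, hb, fun i hi => ?_, rfl⟩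
    have h0 := hl i hi
    have : i ≠ k + 1 := by
      rintro rfl
      exact not_pres_of_nodup hb hi (by omega) (by omega) py'
    omega
  · rintro ⟨y, hy, rfl⟩
    refine ⟨⟨y, DD_mono (by omega) hy, rfl⟩, ⟨y, DD_mono (by omega) hy, ?_⟩⟩
    obtain ⟨b, hb, hl, rfl⟩ := hy
    exact (prod_comm (fun i hi => by have := hl i hi; omega)).symm

theorem DD_zero {n : ℕ} : DD n 0 = {1} := by
  ext x
  constructor
  · rintro ⟨b, _, hl, rfl⟩
    have : b = [] := List.eq_nil_iff_forall_not_mem.2 (fun i hi => by have := hl i hi; omega)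
    rw [this, prodA_nil]; rfl
  · rintro rfl
    exact ⟨[], by simp, by simp, prodA_nil n⟩

theorem DD_card {n : ℕ} (k : ℕ) (hk : k < n) :
    (DD n k).ncard = Nat.fib (2 * k + 1) := by
  induction k using Nat.strong_induction_on with
  | _ k ih =>
    match k with
    | 0 => simp [DD_zero]
    | 1 =>
      rw [DD_succ, Set.ncard_union_eq (DD_disj hk) (Set.toFinite _) (Set.toFinite _), DD_zero]
      simp [Nat.fib]
    | k + 2 =>
      have h0 := ih k (by omega) (by omega)
      have h1 := ih (k + 1) (by omega) (by omega)
      rw [DD_succ, Set.ncard_union_eq (DD_disj hk) (Set.toFinite _) (Set.toFinite _)]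
      have h2 := Set.ncard_union_add_ncard_inter ((fun y => y * sA n (k + 2)) '' DD n (k + 1))
        ((fun y => sA n (k + 2) * y) '' DD n (k + 1)) (Set.toFinite _) (Set.toFinite _)
      rw [DD_inter hk, Set.ncard_image_of_injective _ (mul_left_injective _),
        Set.ncard_image_of_injective _ (mul_left_injective _),
        Set.ncard_image_of_injective _ (mul_right_injective _), h0, h1] at h2
      rw [h1]
      have f1 : Nat.fib (2 * (k + 2) + 1) = Nat.fib (2 * k + 3) + Nat.fib (2 * k + 4) :=
        Nat.fib_add_two
      have f2 : Nat.fib (2 * k + 4) = Nat.fib (2 * k + 2) + Nat.fib (2 * k + 3) := Nat.fib_add_two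
      have f3 : Nat.fib (2 * k + 3) = Nat.fib (2 * k + 1) + Nat.fib (2 * k + 2) := Nat.fib_add_two
      have f4 : 2 * (k + 1) + 1 = 2 * k + 3 := by ring
      rw [f4] at h2 ⊢
      have f5 : k + 1 + 1 = k + 2 := rfl
      rw [f5]
      omega

theorem stmt2 (n : ℕ) (hn : 1 ≤ n) :
    Nat.card {w : Equiv.Perm (Fin n) // BooleanA n w} = Nat.fib (2 * n - 1) := by
  have h : {w : Equiv.Perm (Fin n) | BooleanA n w} = DD n (n - 1) := by
    ext x
    constructor
    · intro hx
      exact nodup_of_boolean hn hx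
    · rintro ⟨b, hb, hl, rfl⟩
      exact boolean_of_nodup hn hb hl
  have h1 : Nat.card {w : Equiv.Perm (Fin n) // BooleanA n w} =
      {w : Equiv.Perm (Fin n) | BooleanA n w}.ncard := rfl
  rw [h1, h, DD_card _ (by omega)]
  congr 1
  omega

end Paper
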